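/- Suppose Ψ̃_k(1) ≠ 0. Let Δ > 0 and let d_Δ be a minimizer of ℓ̃_k over the set {d ∈ ℝ^n : ‖d‖_LP ≤ Δ}. Then ‖d_Δ‖_LP ≥ min(Δ, Ψ̃_k(1)/L_ℓ), where L_ℓ = γ L_ω (L_F + ε_F'). -/

import Mathlib

/-- A convex function that is minimal at `x` over a ball of radius `Δ` of a seminorm-like
function `N`, with `N x < Δ`, is globally minimal at `x`. -/
theorem ConvexOn.le_of_minimal_on_gauge_ball {E : Type*} [AddCommGroup E] [Module ℝ E]
    {f N : E → ℝ} (hf : ConvexOn ℝ Set.univ f)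
    (htri : ∀ u v, N (u + v) ≤ N u + N v) (hsmul : ∀ (c : ℝ) u, N (c • u) = |c| * N u)
    (hnonneg : ∀ u, 0 ≤ N u) {Δ : ℝ} {x : E} (hx : N x < Δ)
    (hmin : ∀ y, N y ≤ Δ → f x ≤ f y) (y : E) : f x ≤ f y := by
  set r := Δ - N x
  have hrpos : 0 < r := sub_pos.mpr hx
  set m := N (y - x)
  have hm : 0 ≤ m := hnonneg _
  set t := r / (r + m)
  have ht : 0 < t := by positivity
  have ht1 : t ≤ 1 := (div_le_one (by positivity)).mpr (by linarith)
  have htm : t * m ≤ r := by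
    rw [div_mul_eq_mul_div, div_le_iff₀ (by positivity)]
    nlinarith
  have hball : N (x + t • (y - x)) ≤ Δ := by
    have h := htri x (t • (y - x))
    rw [hsmul, abs_of_pos ht] at h
    linarith
  have hconv := hf.2 (Set.mem_univ x) (Set.mem_univ y) (sub_nonneg.mpr ht1) ht.le
    (sub_add_cancel 1 t)
  have hpt : (1 - t) • x + t • y = x + t • (y - x) := by module
  rw [hpt, smul_eq_mul, smul_eq_mul] at hconv
  have h := (hmin _ hball).trans hconv
  exact le_of_mul_le_mul_left (by linarith) ht

/-- The derivative of an `L`-Lipschitz function is bounded by `L` pointwise, without assuming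
`0 ≤ L`. -/
theorem HasFDerivAt.norm_apply_le_of_norm_sub_le {E G : Type*} [NormedAddCommGroup E]
    [NormedSpace ℝ E] [NormedAddCommGroup G] [NormedSpace ℝ G] {f : E → G} {f' : E →L[ℝ] G}
    {x : E} (hf : HasFDerivAt f f' x) {L : ℝ} (hL : ∀ x y, ‖f x - f y‖ ≤ L * ‖x - y‖) (v : E) :
    ‖f' v‖ ≤ L * ‖v‖ := by
  rcases eq_or_ne v 0 with rfl | hv
  · simp
  have hL0 : 0 ≤ L := by
    have h := (norm_nonneg _).trans (hL v 0)
    rw [sub_zero] at h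
    exact nonneg_of_mul_nonneg_left h (norm_pos_iff.mpr hv)
  exact f'.le_of_opNorm_le
    (hf.le_of_lip' hL0 (Filter.Eventually.of_forall fun y => hL y x)) v

/-- Suppose `Ψ̃ₖ(1) ≠ 0`. If `d_Δ` minimizes the noisy
linearized model `ℓ̃ₖ(d) = ω(F̃(xₖ) + F̃'(xₖ) d)` over `{d : nLP d ≤ Δ}` for
some `Δ > 0`, then `nLP d_Δ ≥ min(Δ, Ψ̃ₖ(1)/Lℓ)` with `Lℓ = γ Lω (LF + εF')`. -/
theorem lp_step_criticality_bound
    (n p : ℕ)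
    (ω : EuclideanSpace ℝ (Fin p) → ℝ) (Lω : ℝ)
    (hωconv : ConvexOn ℝ Set.univ ω)
    (hωLip : ∀ u v, |ω u - ω v| ≤ Lω * ‖u - v‖)
    (nLP : EuclideanSpace ℝ (Fin n) → ℝ)
    (hLPtri : ∀ u v, nLP (u + v) ≤ nLP u + nLP v)
    (hLPsmul : ∀ (c : ℝ) u, nLP (c • u) = |c| * nLP u)
    (hLPdef : ∀ u, nLP u = 0 → u = 0)
    (γ : ℝ) (hγ : 0 < γ)
    (hγle : ∀ d : EuclideanSpace ℝ (Fin n), ‖d‖ ≤ γ * nLP d)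
    (F : EuclideanSpace ℝ (Fin n) → EuclideanSpace ℝ (Fin p))
    (F' : EuclideanSpace ℝ (Fin n) →
      (EuclideanSpace ℝ (Fin n) →L[ℝ] EuclideanSpace ℝ (Fin p)))
    (hF : ∀ x, HasFDerivAt F (F' x) x)
    (LF : ℝ)
    (hFLip : ∀ x y, ‖F x - F y‖ ≤ LF * ‖x - y‖)
    (δF : EuclideanSpace ℝ (Fin n) → EuclideanSpace ℝ (Fin p))
    (δF' : EuclideanSpace ℝ (Fin n) →
      (EuclideanSpace ℝ (Fin n) →L[ℝ] EuclideanSpace ℝ (Fin p)))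
    (εF εF' : ℝ)
    (hδF : ∀ x, ‖δF x‖ ≤ εF)
    (hδF' : ∀ x, ‖δF' x‖ ≤ εF')
    (xk : EuclideanSpace ℝ (Fin n))
    (hΨ : ω (F xk + δF xk) -
        sInf ((fun d => ω (F xk + δF xk + (F' xk + δF' xk) d)) '' {d | nLP d ≤ 1}) ≠ 0)
    (Δ : ℝ) (hΔ : 0 < Δ)
    (dΔ : EuclideanSpace ℝ (Fin n))
    (hdΔfeas : nLP dΔ ≤ Δ)
    (hdΔmin : ∀ d : EuclideanSpace ℝ (Fin n), nLP d ≤ Δ →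
      ω (F xk + δF xk + (F' xk + δF' xk) dΔ) ≤
        ω (F xk + δF xk + (F' xk + δF' xk) d)) :
    nLP dΔ ≥
      min Δ
        ((ω (F xk + δF xk) -
            sInf ((fun d => ω (F xk + δF xk + (F' xk + δF' xk) d)) '' {d | nLP d ≤ 1})) /
          (γ * Lω * (LF + εF'))) := by
  set A := F' xk + δF' xk
  set c := F xk + δF xk
  set ℓ : EuclideanSpace ℝ (Fin n) → ℝ := fun d => ω (c + A d)
  have hnonneg : ∀ d, 0 ≤ nLP d := fun d =>
    nonneg_of_mul_nonneg_right ((norm_nonneg d).trans (hγle d)) hγ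
  have hzero : nLP 0 ≤ 1 := by
    have h := hLPsmul 0 0
    rw [zero_smul, abs_zero, zero_mul] at h
    linarith
  have hne : (ℓ '' {d | nLP d ≤ 1}).Nonempty := ⟨_, 0, hzero, rfl⟩
  have hA : ∀ d, ‖A d‖ ≤ (LF + εF') * ‖d‖ := fun d => by
    have h₁ := (hF xk).norm_apply_le_of_norm_sub_le hFLip d
    have h₂ := (δF' xk).le_of_opNorm_le (hδF' xk) d
    calc ‖A d‖ ≤ ‖F' xk d‖ + ‖δF' xk d‖ := norm_add_le _ _
      _ ≤ (LF + εF') * ‖d‖ := by linarith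
  have hdiff : ∀ d, |ω c - ℓ d| ≤ Lω * ‖A d‖ := fun d => by
    simpa using hωLip c (c + A d)
  obtain ⟨d, hd⟩ : ∃ d, ω c - ℓ d ≠ 0 := by
    by_contra! h
    have himg : ℓ '' {d | nLP d ≤ 1} = {ω c} :=
      Set.eq_singleton_iff_nonempty_unique_mem.mpr ⟨hne, by
        rintro _ ⟨d, -, rfl⟩
        linarith [h d]⟩
    exact hΨ (by rw [himg, csInf_singleton, sub_self])
  have hpos : 0 < Lω * ‖A d‖ := (abs_pos.mpr hd).trans_le (hdiff d)
  have hLω : 0 < Lω := pos_of_mul_pos_left hpos (norm_nonneg _)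
  have hAd : 0 < ‖A d‖ := pos_of_mul_pos_right hpos hLω.le
  have hL : 0 < LF + εF' :=
    pos_of_mul_pos_left (hAd.trans_le (hA d)) (norm_nonneg _)
  rcases hdΔfeas.eq_or_lt with heq | hlt
  · exact heq ▸ min_le_left _ _
  have hconv : ConvexOn ℝ Set.univ ℓ :=
    (hωconv.translate_right c).comp_linearMap A.toLinearMap
  have hglobal := hconv.le_of_minimal_on_gauge_ball hLPtri hLPsmul hnonneg hlt hdΔmin
  have hInf : ℓ dΔ ≤ sInf (ℓ '' {d | nLP d ≤ 1}) :=
    le_csInf hne (by rintro _ ⟨d, -, rfl⟩; exact hglobal d)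
  refine (min_le_right _ _).trans ((div_le_iff₀ (by positivity)).mpr ?_)
  calc ω c - sInf (ℓ '' {d | nLP d ≤ 1}) ≤ ω c - ℓ dΔ := by linarith
    _ ≤ Lω * ‖A dΔ‖ := (le_abs_self _).trans (hdiff dΔ)
    _ ≤ Lω * ((LF + εF') * (γ * nLP dΔ)) := by
      gcongr
      exact (hA dΔ).trans (by gcongr; exact hγle dΔ)
    _ = nLP dΔ * (γ * Lω * (LF + εF')) := by ring
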